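/- arXiv:1102.3466 — 2 statements merged into one kernel-verified Lean document; each statement's English description precedes it below -/
import Mathlib

section
/- For every sufficiently large L and every i ∈ {0,…,2L−2}, the exterior boundary in ℤ⁴ of D := 𝒞_L^{(i)} \ 𝒞_L^{(i+2)} decomposes as the disjoint union ∂D = (D − e₄) ⊔ (D + e₄) ⊔ ((∂⁻𝒮_{L,i+2}) × {1}) ⊔ ((∂𝒮_{L,0}) × {⌈i/2⌉ + 1}), where e₄ := (0,0,0,1) and D ± e₄ := {x ± e₄ : x ∈ D}. For i ∈ {2L−1,…,4L} the same decomposition holds with the last set replaced by (∂𝒮_{L,i−2(L−1)}) × {L}. -/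
/-- Sites of the lattice `ℤ^d`. -/
abbrev Site (d : ℕ) := Fin d → ℤ

/-- Nearest-neighbour adjacency in `ℤ^d`. -/
def adjacent {d : ℕ} (x y : Site d) : Prop := (∑ i, |x i - y i|) = 1

/-- Exterior boundary of a set of sites: the sites outside `A` having a neighbour in `A`. -/
def extBoundary {d : ℕ} (A : Set (Site d)) : Set (Site d) :=
  {y | y ∉ A ∧ ∃ x ∈ A, adjacent x y}

/-- Internal boundary of a set of sites: the sites of `A` having a neighbour outside `A`. -/
def intBoundary {d : ℕ} (A : Set (Site d)) : Set (Site d) :=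
  {y | y ∈ A ∧ ∃ x, x ∉ A ∧ adjacent x y}

/-- The three-dimensional discrete ball `S³_r` of radius `r`. -/
def ball3 (r : ℝ) : Set (Site 3) :=
  {z | ((z 0 : ℝ) ^ 2 + (z 1 : ℝ) ^ 2 + (z 2 : ℝ) ^ 2 ≤ r ^ 2)}

/-- The exponent `c₂ = 3/2`. -/
noncomputable def c₂ : ℝ := 3 / 2

/-- The cylinder `𝒞_L = S³_{8L(log L)^{c₂}} × {1,…,L} ⊆ ℤ⁴`. -/
noncomputable def cyl (L : ℕ) : Set (Site 4) :=
  {z | (fun i : Fin 3 => z i.castSucc) ∈ ball3 (8 * L * Real.log L ^ c₂) ∧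
        1 ≤ z 3 ∧ z 3 ≤ (L : ℤ)}

/-- The ball `𝒮_{L,k} = S³_{(8L-k)(log L)^{c₂}}`. -/
noncomputable def SL (L : ℕ) (k : ℝ) : Set (Site 3) :=
  ball3 ((8 * L - k) * Real.log L ^ c₂)

/-- The set `𝒞_L^{(i)} = 𝒞_L ∩ {z : (z₁,z₂,z₃) ∈ 𝒮_{L,(i-2z₄+2)₊}}`. -/
noncomputable def cylI (L i : ℕ) : Set (Site 4) :=
  cyl L ∩ {z | (fun j : Fin 3 => z j.castSucc)
      ∈ SL L (max ((i : ℝ) - 2 * (z 3 : ℝ) + 2) 0)}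

/-- The unit vector `e₄ = (0,0,0,1)` of `ℤ⁴`. -/
def e4 : Site 4 := Pi.single 3 1

/-- The layer `A × {m} ⊆ ℤ⁴` over a set `A ⊆ ℤ³`. -/
def layer (A : Set (Site 3)) (m : ℤ) : Set (Site 4) :=
  {z | (fun i : Fin 3 => z i.castSucc) ∈ A ∧ z 3 = m}

theorem adjacent_comm {d : ℕ} {x y : Site d} : adjacent x y ↔ adjacent y x := by
  simp only [adjacent, abs_sub_comm]

/-- Adjacency in `ℤ⁴` is either horizontal or vertical. -/
theorem adjacent_iff_horizontal_or_vertical (x y : Site 4) :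
    adjacent x y ↔
      (adjacent (fun j : Fin 3 => x j.castSucc) (fun j : Fin 3 => y j.castSucc) ∧ x 3 = y 3) ∨
      ((fun j : Fin 3 => x j.castSucc) = (fun j : Fin 3 => y j.castSucc) ∧ |x 3 - y 3| = 1) := by
  have hzero : ∀ i, |x i - y i| = 0 ↔ x i = y i := fun i => by rw [abs_eq_zero, sub_eq_zero]
  have hproj : (fun j : Fin 3 => x j.castSucc) = (fun j : Fin 3 => y j.castSucc) ↔
      x 0 = y 0 ∧ x 1 = y 1 ∧ x 2 = y 2 :=
    ⟨fun h => ⟨congrFun h 0, congrFun h 1, congrFun h 2⟩, fun ⟨h₀, h₁, h₂⟩ => by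
      funext j; fin_cases j <;> assumption⟩
  rw [hproj, ← hzero, ← hzero, ← hzero, ← hzero, adjacent, adjacent, Fin.sum_univ_four,
    Fin.sum_univ_three]
  change _ ↔ |x 0 - y 0| + |x 1 - y 1| + |x 2 - y 2| = 1 ∧ _ ∨ _
  have h₀ := abs_nonneg (x 0 - y 0)
  have h₁ := abs_nonneg (x 1 - y 1)
  have h₂ := abs_nonneg (x 2 - y 2)
  have h₃ := abs_nonneg (x 3 - y 3)
  omega

/-- The site of `ℤ⁴` over `w` at height `m`. -/
def siteOver (w : Site 3) (m : ℤ) : Site 4 := ![w 0, w 1, w 2, m]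

theorem siteOver_castSucc (w : Site 3) (m : ℤ) : (fun j : Fin 3 => siteOver w m j.castSucc) = w := by
  funext j; fin_cases j <;> rfl

theorem siteOver_height (w : Site 3) (m : ℤ) : siteOver w m 3 = m := rfl

theorem sub_e4_castSucc (x : Site 4) :
    (fun j : Fin 3 => (x - e4) j.castSucc) = fun j : Fin 3 => x j.castSucc := by
  funext j; fin_cases j <;> simp [e4]

theorem add_e4_castSucc (x : Site 4) :
    (fun j : Fin 3 => (x + e4) j.castSucc) = fun j : Fin 3 => x j.castSucc := by
  funext j; fin_cases j <;> simp [e4]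

theorem sub_e4_height (x : Site 4) : (x - e4) 3 = x 3 - 1 := by simp [e4]

theorem add_e4_height (x : Site 4) : (x + e4) 3 = x 3 + 1 := by simp [e4]

/-- The union of the layers `(B m \ B (m - 1)) × {m}` over `1 ≤ m ≤ M`. -/
def staircase (B : ℤ → Set (Site 3)) (M : ℤ) : Set (Site 4) :=
  {z | 1 ≤ z 3 ∧ z 3 ≤ M ∧ (fun j : Fin 3 => z j.castSucc) ∈ B (z 3) ∧
    (fun j : Fin 3 => z j.castSucc) ∉ B (z 3 - 1)}

theorem image_sub_e4 (A : Set (Site 4)) : (fun x => x - e4) '' A = {x | x + e4 ∈ A} := by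
  ext x; exact ⟨by rintro ⟨y, hy, rfl⟩; simpa using hy, fun h => ⟨_, h, by simp⟩⟩

theorem image_add_e4 (A : Set (Site 4)) : (fun x => x + e4) '' A = {x | x - e4 ∈ A} := by
  ext x; exact ⟨by rintro ⟨y, hy, rfl⟩; simpa using hy, fun h => ⟨_, h, by simp⟩⟩

theorem mem_add_e4_staircase (B : ℤ → Set (Site 3)) (M : ℤ) (x : Site 4) :
    x + e4 ∈ staircase B M ↔ 0 ≤ x 3 ∧ x 3 + 1 ≤ M ∧
      (fun j : Fin 3 => x j.castSucc) ∈ B (x 3 + 1) ∧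
      (fun j : Fin 3 => x j.castSucc) ∉ B (x 3) := by
  simp only [staircase, Set.mem_ofPred_eq, add_e4_castSucc, add_e4_height, add_sub_cancel_right]
  rw [show 1 ≤ x 3 + 1 ↔ 0 ≤ x 3 by omega]

theorem mem_sub_e4_staircase (B : ℤ → Set (Site 3)) (M : ℤ) (x : Site 4) :
    x - e4 ∈ staircase B M ↔ 2 ≤ x 3 ∧ x 3 - 1 ≤ M ∧
      (fun j : Fin 3 => x j.castSucc) ∈ B (x 3 - 1) ∧
      (fun j : Fin 3 => x j.castSucc) ∉ B (x 3 - 2) := by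
  simp only [staircase, Set.mem_ofPred_eq, sub_e4_castSucc, sub_e4_height]
  rw [show 1 ≤ x 3 - 1 ↔ 2 ≤ x 3 by omega, show x 3 - 1 - 1 = x 3 - 2 by ring]

theorem extBoundary_staircase {B : ℤ → Set (Site 3)} {M : ℤ} (hM : 1 ≤ M)
    (hstep : ∀ m, 0 ≤ m → m < M → ∀ x ∈ B m, ∀ y, adjacent x y → y ∈ B (m + 1)) :
    extBoundary (staircase B M) =
      (fun x => x - e4) '' staircase B M ∪ (fun x => x + e4) '' staircase B M ∪
        layer (intBoundary (B 0)) 1 ∪ layer (extBoundary (B M)) M := by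
  ext y
  simp only [image_sub_e4, image_add_e4, Set.mem_union, Set.mem_ofPred_eq, mem_add_e4_staircase,
    mem_sub_e4_staircase, layer, extBoundary, intBoundary]
  constructor
  · rintro ⟨hy, x, ⟨hx₁, hx₂, hx₃, hx₄⟩, hxy⟩
    rcases (adjacent_iff_horizontal_or_vertical x y).1 hxy with ⟨hadj, hh⟩ | ⟨hproj, hh⟩
    · rw [hh] at hx₁ hx₂ hx₃ hx₄
      by_cases hw : (fun j : Fin 3 => y j.castSucc) ∈ B (y 3 - 1)
      · rcases hx₁.eq_or_lt with h | h
        · rw [← h, sub_self] at hw hx₄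
          exact .inl (.inr ⟨⟨hw, _, hx₄, hadj⟩, h.symm⟩)
        · refine .inl (.inl (.inr ⟨by omega, by omega, hw, fun hc => hx₄ ?_⟩))
          have := hstep (y 3 - 2) (by omega) (by omega) _ hc _ (adjacent_comm.1 hadj)
          rwa [show y 3 - 2 + 1 = y 3 - 1 by ring] at this
      · have hw' : (fun j : Fin 3 => y j.castSucc) ∉ B (y 3) := fun h => hy ⟨hx₁, hx₂, h, hw⟩
        rcases hx₂.eq_or_lt with h | h
        · rw [h] at hw' hx₃
          exact .inr ⟨⟨hw', _, hx₃, hadj⟩, h⟩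
        · exact .inl (.inl (.inl ⟨by omega, by omega,
            hstep _ (by omega) h _ hx₃ _ hadj, hw'⟩))
    · rw [hproj] at hx₃ hx₄
      rcases (abs_eq zero_le_one).1 hh with h | h
      · obtain h : x 3 = y 3 + 1 := by omega
        rw [h] at hx₁ hx₂ hx₃ hx₄
        exact .inl (.inl (.inl ⟨by omega, hx₂, hx₃, by simpa using hx₄⟩))
      · obtain h : x 3 = y 3 - 1 := by omega
        rw [h] at hx₁ hx₂ hx₃ hx₄
        rw [show y 3 - 1 - 1 = y 3 - 2 by ring] at hx₄
        exact .inl (.inl (.inr ⟨by omega, hx₂, hx₃, hx₄⟩))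
  · rintro (((⟨h₁, h₂, h₃, h₄⟩ | ⟨h₁, h₂, h₃, h₄⟩) | ⟨⟨h₁, x, h₂, h₃⟩, h₄⟩) |
      ⟨⟨h₁, x, h₂, h₃⟩, h₄⟩)
    · refine ⟨fun h => h₄ h.2.2.1, y + e4,
        (mem_add_e4_staircase _ _ _).2 ⟨h₁, h₂, h₃, h₄⟩, ?_⟩
      rw [adjacent_iff_horizontal_or_vertical, add_e4_castSucc, add_e4_height]
      simp
    · refine ⟨fun h => h.2.2.2 h₃, y - e4,
        (mem_sub_e4_staircase _ _ _).2 ⟨h₁, h₂, h₃, h₄⟩, ?_⟩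
      rw [adjacent_iff_horizontal_or_vertical, sub_e4_castSucc, sub_e4_height]
      simp
    · refine ⟨fun h => h.2.2.2 (by simpa [h₄] using h₁), siteOver x 1, ?_, ?_⟩
      · have := hstep 0 le_rfl (by omega) _ h₁ _ (adjacent_comm.1 h₃)
        simp only [staircase, Set.mem_ofPred_eq, siteOver_castSucc, siteOver_height]
        exact ⟨le_rfl, hM, by simpa using this, by simpa using h₂⟩
      · rw [adjacent_iff_horizontal_or_vertical, siteOver_castSucc, siteOver_height]
        exact .inl ⟨h₃, h₄.symm⟩
    · refine ⟨fun h => h₁ (by simpa [h₄] using h.2.2.1), siteOver x M, ?_, ?_⟩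
      · simp only [staircase, Set.mem_ofPred_eq, siteOver_castSucc, siteOver_height]
        refine ⟨hM, le_rfl, h₂, fun hc => h₁ ?_⟩
        have := hstep (M - 1) (by omega) (by omega) _ hc _ h₃
        rwa [sub_add_cancel] at this
      · rw [adjacent_iff_horizontal_or_vertical, siteOver_castSucc, siteOver_height]
        exact .inl ⟨h₃, h₄.symm⟩

theorem pairwise_disjoint_staircase {B : ℤ → Set (Site 3)} {M : ℤ} (hM : 1 ≤ M)
    (hmono : MonotoneOn B (Set.Icc 0 M)) :
    Pairwise (Function.onFun Disjoint
      (![(fun x => x - e4) '' staircase B M, (fun x => x + e4) '' staircase B M,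
        layer (intBoundary (B 0)) 1, layer (extBoundary (B M)) M] : Fin 4 → Set (Site 4))) := by
  have hsub : ∀ {a b : ℤ} {w}, 0 ≤ a → a ≤ b → b ≤ M → w ∈ B a → w ∈ B b :=
    fun h₀ h₁ h₂ h => hmono ⟨h₀, h₁.trans h₂⟩ ⟨h₀.trans h₁, h₂⟩ h₁ h
  have h01 : Disjoint ((fun x => x - e4) '' staircase B M)
      ((fun x => x + e4) '' staircase B M) := by
    rw [Set.disjoint_left, image_sub_e4, image_add_e4]
    intro x h h'
    obtain ⟨h₁, h₂, h₃, h₄⟩ := (mem_add_e4_staircase _ _ _).1 h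
    obtain ⟨h₁', h₂', h₃', h₄'⟩ := (mem_sub_e4_staircase _ _ _).1 h'
    exact h₄ (hsub (by omega) (by omega) (by omega) h₃')
  have h02 : Disjoint ((fun x => x - e4) '' staircase B M) (layer (intBoundary (B 0)) 1) := by
    rw [Set.disjoint_left, image_sub_e4]
    intro x h h'
    obtain ⟨h₁, h₂, h₃, h₄⟩ := (mem_add_e4_staircase _ _ _).1 h
    exact h₄ (hsub le_rfl h₁ (by omega) h'.1.1)
  have h03 : Disjoint ((fun x => x - e4) '' staircase B M) (layer (extBoundary (B M)) M) := by
    rw [Set.disjoint_left, image_sub_e4]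
    intro x h h'
    obtain ⟨h₁, h₂, h₃, h₄⟩ := (mem_add_e4_staircase _ _ _).1 h
    exact h'.1.1 (hsub (by omega) h₂ le_rfl h₃)
  have h12 : Disjoint ((fun x => x + e4) '' staircase B M) (layer (intBoundary (B 0)) 1) := by
    rw [Set.disjoint_left, image_add_e4]
    intro x h h'
    obtain ⟨h₁, h₂, h₃, h₄⟩ := (mem_sub_e4_staircase _ _ _).1 h
    exact h₄ (hsub le_rfl (by omega) (by omega) h'.1.1)
  have h13 : Disjoint ((fun x => x + e4) '' staircase B M) (layer (extBoundary (B M)) M) := by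
    rw [Set.disjoint_left, image_add_e4]
    intro x h h'
    obtain ⟨h₁, h₂, h₃, h₄⟩ := (mem_sub_e4_staircase _ _ _).1 h
    exact h'.1.1 (hsub (by omega) h₂ le_rfl h₃)
  have h23 : Disjoint (layer (intBoundary (B 0)) 1) (layer (extBoundary (B M)) M) := by
    rw [Set.disjoint_left]
    intro x h h'
    exact h'.1.1 (hsub le_rfl (by omega) le_rfl h.1.1)
  intro a b hab
  fin_cases a <;> fin_cases b <;> first
    | exact absurd rfl hab
    | assumption
    | (apply Disjoint.symm; assumption)

theorem ball3_mono {r s : ℝ} (hr : 0 ≤ r) (hrs : r ≤ s) : ball3 r ⊆ ball3 s :=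
  fun _ hz => le_trans (Set.mem_ofPred_eq ▸ hz) (by gcongr)

theorem mem_ball3_of_adjacent {r s : ℝ} (hr : 0 ≤ r) (hrs : r + 1 ≤ s) {x y : Site 3}
    (hx : x ∈ ball3 r) (hxy : adjacent x y) : y ∈ ball3 s := by
  have hx' : (x 0 : ℝ) ^ 2 + (x 1 : ℝ) ^ 2 + (x 2 : ℝ) ^ 2 ≤ r ^ 2 := hx
  refine ball3_mono (by linarith) hrs ?_
  change (y 0 : ℝ) ^ 2 + (y 1 : ℝ) ^ 2 + (y 2 : ℝ) ^ 2 ≤ (r + 1) ^ 2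
  have hsum : |(x 0 : ℝ) - y 0| + |(x 1 : ℝ) - y 1| + |(x 2 : ℝ) - y 2| = 1 := by
    rw [adjacent, Fin.sum_univ_three] at hxy
    exact_mod_cast hxy
  have key : ∀ a b : ℝ, a ^ 2 ≤ r ^ 2 → |a - b| ≤ 1 →
      b ^ 2 ≤ a ^ 2 + (2 * r + 1) * |a - b| := by
    intro a b ha hab
    have h₁ := abs_le_of_sq_le_sq ha hr
    have h₂ := abs_nonneg (a - b)
    have h₃ := neg_abs_le (a * (a - b))
    rw [abs_mul] at h₃
    nlinarith [sq_abs (a - b), mul_le_mul_of_nonneg_right h₁ h₂]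
  have n₀ := abs_nonneg ((x 0 : ℝ) - y 0)
  have n₁ := abs_nonneg ((x 1 : ℝ) - y 1)
  have n₂ := abs_nonneg ((x 2 : ℝ) - y 2)
  have k₀ := key (x 0) (y 0) (by nlinarith [sq_nonneg (x 1 : ℝ), sq_nonneg (x 2 : ℝ)])
    (by linarith)
  have k₁ := key (x 1) (y 1) (by nlinarith [sq_nonneg (x 0 : ℝ), sq_nonneg (x 2 : ℝ)])
    (by linarith)
  have k₂ := key (x 2) (y 2) (by nlinarith [sq_nonneg (x 1 : ℝ), sq_nonneg (x 0 : ℝ)])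
    (by linarith)
  have : (2 * r + 1) * (|(x 0 : ℝ) - y 0| + |(x 1 : ℝ) - y 1| + |(x 2 : ℝ) - y 2|) =
    2 * r + 1 := by rw [hsum, mul_one]
  linarith

theorem one_le_log_rpow {L : ℕ} (hL : 3 ≤ L) : 1 ≤ Real.log L ^ c₂ := by
  refine Real.one_le_rpow ?_ (by norm_num [c₂])
  rw [Real.le_log_iff_exp_le (by positivity)]
  have : (3 : ℝ) ≤ L := by exact_mod_cast hL
  linarith [Real.exp_one_lt_three]

theorem SL_anti {L : ℕ} (hL : 3 ≤ L) {k k' : ℝ} (hk : k ≤ k') (hk' : k' ≤ 8 * L) :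
    SL L k' ⊆ SL L k := by
  have := one_le_log_rpow hL
  refine ball3_mono (mul_nonneg (by linarith) (by linarith)) ?_
  gcongr

theorem mem_SL_of_adjacent {L : ℕ} (hL : 3 ≤ L) {k k' : ℝ} (hk : k + 1 ≤ k')
    (hk' : k' ≤ 8 * L) {x y : Site 3} (hx : x ∈ SL L k') (hxy : adjacent x y) : y ∈ SL L k := by
  have := one_le_log_rpow hL
  exact mem_ball3_of_adjacent (mul_nonneg (by linarith) (by linarith)) (by nlinarith) hx hxy

/-- The horizontal section of `𝒞_L^{(i)}` at height `m ∈ {1,…,L}`. -/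
noncomputable def cylSection (L i : ℕ) (m : ℤ) : Set (Site 3) :=
  SL L (max ((i : ℝ) - 2 * (m : ℝ) + 2) 0)

theorem cylSection_of_le {L i : ℕ} {m : ℤ} (h : i + 2 ≤ 2 * m) : cylSection L i m = SL L 0 := by
  rw [cylSection, max_eq_right]
  have : (i : ℝ) + 2 ≤ 2 * m := by exact_mod_cast h
  linarith

theorem cylSection_monotoneOn {L i : ℕ} (hL : 3 ≤ L) (hi : i ≤ 4 * L) :
    MonotoneOn (cylSection L i) (Set.Ici 0) := by
  intro m hm m' _ hmm
  have hm : (0 : ℝ) ≤ m := by exact_mod_cast hm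
  have hi : (i : ℝ) ≤ 4 * L := by exact_mod_cast hi
  have hL' : (3 : ℝ) ≤ L := by exact_mod_cast hL
  refine SL_anti hL (by gcongr) (max_le ?_ ?_) <;> linarith

theorem cylSection_step {L i : ℕ} (hL : 3 ≤ L) (hi : i ≤ 4 * L) {m : ℤ} (hm : 0 ≤ m)
    (hmi : 2 * m ≤ i + 1) {x y : Site 3} (hx : x ∈ cylSection L i m) (hxy : adjacent x y) :
    y ∈ cylSection L i (m + 1) := by
  have hm : (0 : ℝ) ≤ m := by exact_mod_cast hm
  have hi : (i : ℝ) ≤ 4 * L := by exact_mod_cast hi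
  have hL' : (3 : ℝ) ≤ L := by exact_mod_cast hL
  have hmi : 2 * (m : ℝ) ≤ i + 1 := by exact_mod_cast hmi
  refine mem_SL_of_adjacent hL ?_ (max_le ?_ ?_) hx hxy
  · rw [← le_sub_iff_add_le]
    push_cast
    refine max_le ?_ ?_ <;>
      linarith [le_max_left ((i : ℝ) - 2 * (m : ℝ) + 2) 0]
  · linarith
  · linarith

theorem cylI_diff_eq_staircase {L i : ℕ} (hL : 3 ≤ L) (hi : i ≤ 4 * L) {M : ℤ} (hM : M ≤ L)
    (htop : M = L ∨ i + 2 ≤ 2 * M) :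
    cylI L i \ cylI L (i + 2) = staircase (cylSection L i) M := by
  have hcyl : ∀ z : Site 4, 1 ≤ z 3 → (fun j : Fin 3 => z j.castSucc) ∈ cylSection L i (z 3) →
      (fun j : Fin 3 => z j.castSucc) ∈ ball3 (8 * L * Real.log L ^ c₂) := by
    intro z hz h
    have h₁ : (0 : ℝ) < z 3 := by exact_mod_cast hz
    have h₂ : (i : ℝ) ≤ 4 * L := by exact_mod_cast hi
    have h₃ : (3 : ℝ) ≤ L := by exact_mod_cast hL
    have := SL_anti hL (le_max_right _ 0) (max_le (by linarith) (by linarith)) h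
    rwa [SL, sub_zero] at this
  have hshift : ∀ m : ℤ, SL L (max (((i + 2 : ℕ) : ℝ) - 2 * (m : ℝ) + 2) 0) =
      cylSection L i (m - 1) := by
    intro m
    rw [cylSection]
    push_cast
    ring_nf
  ext z
  simp only [cylI, cyl, staircase, Set.mem_sdiff, Set.mem_inter_iff, Set.mem_ofPred_eq, hshift]
  rw [← cylSection]
  constructor
  · rintro ⟨⟨⟨h₁, h₂, h₃⟩, h₄⟩, h₅⟩
    have h₆ : (fun j : Fin 3 => z j.castSucc) ∉ cylSection L i (z 3 - 1) :=
      fun h => h₅ ⟨⟨h₁, h₂, h₃⟩, h⟩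
    refine ⟨h₂, ?_, h₄, h₆⟩
    rcases htop with rfl | htop
    · exact h₃
    · by_contra! hlt
      rw [cylSection_of_le (by omega)] at h₄ h₆
      exact h₆ h₄
  · rintro ⟨h₁, h₂, h₃, h₄⟩
    exact ⟨⟨⟨hcyl z h₁ h₃, h₁, h₂.trans hM⟩, h₃⟩, fun h => h₄ h.2⟩

theorem boundary_decomposition_of_top {L i : ℕ} (hL : 3 ≤ L) (hi : i ≤ 4 * L) {M : ℤ}
    (hM₁ : 1 ≤ M) (hM : M ≤ L) (htop : M = L ∨ i + 2 ≤ 2 * M) (hMi : 2 * M ≤ i + 3)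
    {S : Set (Site 3)} (hS : cylSection L i M = S) :
    extBoundary (cylI L i \ cylI L (i + 2)) =
        ⋃ j, (![(fun x => x - e4) '' (cylI L i \ cylI L (i + 2)),
                (fun x => x + e4) '' (cylI L i \ cylI L (i + 2)),
                layer (intBoundary (SL L ((i : ℝ) + 2))) 1,
                layer (extBoundary S) M] : Fin 4 → Set (Site 4)) j ∧
      Pairwise (Function.onFun Disjoint
        (![(fun x => x - e4) '' (cylI L i \ cylI L (i + 2)),
           (fun x => x + e4) '' (cylI L i \ cylI L (i + 2)),
           layer (intBoundary (SL L ((i : ℝ) + 2))) 1,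
           layer (extBoundary S) M] : Fin 4 → Set (Site 4))) := by
  have hbot : SL L ((i : ℝ) + 2) = cylSection L i 0 := by
    rw [cylSection, max_eq_left] <;> simp
    positivity
  have hmono := (cylSection_monotoneOn hL hi).mono (fun m (hm : m ∈ Set.Icc 0 M) => hm.1)
  rw [cylI_diff_eq_staircase hL hi hM htop, hbot, ← hS]
  refine ⟨?_, pairwise_disjoint_staircase hM₁ hmono⟩
  rw [extBoundary_staircase hM₁
    fun m hm hmM x hx y => cylSection_step hL hi hm (by omega) hx]
  ext z
  simp [Fin.exists_fin_succ, or_assoc]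

/-- For every sufficiently large `L` and every `i ∈ {0,…,2L-2}`, the
exterior boundary in `ℤ⁴` of `D := 𝒞_L^{(i)} \ 𝒞_L^{(i+2)}` decomposes as the disjoint
union `∂D = (D - e₄) ⊔ (D + e₄) ⊔ ((∂⁻𝒮_{L,i+2}) × {1}) ⊔ ((∂𝒮_{L,0}) × {⌈i/2⌉+1})`;
for `i ∈ {2L-1,…,4L}` the same holds with the last set replaced by
`(∂𝒮_{L,i-2(L-1)}) × {L}`. -/
theorem boundary_decomposition :
    ∃ L₀ : ℕ, ∀ L : ℕ, L₀ ≤ L → ∀ i : ℕ,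
      (i ≤ 2 * L - 2 →
        (extBoundary (cylI L i \ cylI L (i + 2)) =
            ⋃ j, (![(fun x => x - e4) '' (cylI L i \ cylI L (i + 2)),
                    (fun x => x + e4) '' (cylI L i \ cylI L (i + 2)),
                    layer (intBoundary (SL L ((i : ℝ) + 2))) 1,
                    layer (extBoundary (SL L 0)) ((((i + 1) / 2 : ℕ) : ℤ) + 1)] :
                  Fin 4 → Set (Site 4)) j) ∧
          Pairwise (Function.onFun Disjoint
            (![(fun x => x - e4) '' (cylI L i \ cylI L (i + 2)),
               (fun x => x + e4) '' (cylI L i \ cylI L (i + 2)),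
               layer (intBoundary (SL L ((i : ℝ) + 2))) 1,
               layer (extBoundary (SL L 0)) ((((i + 1) / 2 : ℕ) : ℤ) + 1)] :
                Fin 4 → Set (Site 4)))) ∧
      (2 * L - 1 ≤ i → i ≤ 4 * L →
        (extBoundary (cylI L i \ cylI L (i + 2)) =
            ⋃ j, (![(fun x => x - e4) '' (cylI L i \ cylI L (i + 2)),
                    (fun x => x + e4) '' (cylI L i \ cylI L (i + 2)),
                    layer (intBoundary (SL L ((i : ℝ) + 2))) 1,
                    layer (extBoundary (SL L (((i - 2 * (L - 1) : ℕ) : ℝ)))) (L : ℤ)] :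
                  Fin 4 → Set (Site 4)) j) ∧
          Pairwise (Function.onFun Disjoint
            (![(fun x => x - e4) '' (cylI L i \ cylI L (i + 2)),
               (fun x => x + e4) '' (cylI L i \ cylI L (i + 2)),
               layer (intBoundary (SL L ((i : ℝ) + 2))) 1,
               layer (extBoundary (SL L (((i - 2 * (L - 1) : ℕ) : ℝ)))) (L : ℤ)] :
                Fin 4 → Set (Site 4)))) := by
  refine ⟨3, fun L hL i => ⟨fun hi => ?_, fun hi₁ hi₂ => ?_⟩⟩
  · exact boundary_decomposition_of_top hL (by omega) (by omega) (by omega) (.inr (by omega))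
      (by omega) (cylSection_of_le (by omega))
  · refine boundary_decomposition_of_top hL hi₂ (by omega) le_rfl (.inl rfl) (by omega) ?_
    have h : ((i - 2 * (L - 1) : ℕ) : ℝ) = (i : ℝ) - 2 * (L : ℝ) + 2 := by
      rw [Nat.cast_sub (by omega), Nat.cast_mul, Nat.cast_sub (by omega)]
      push_cast
      ring
    rw [cylSection, h, Int.cast_natCast, max_eq_left]
    rw [← h]
    positivity
end

section
/- For every sufficiently large L and every i ∈ {0,…,4L}: (a) 𝒞_L^{(i)} \ 𝒞_L^{(i+2)} is the disjoint union over j ∈ {1,…,L} of the slices (𝒮_{L,(i−2(j−1))₊} \ 𝒮_{L,(i−2(j−1)+2)₊}) × {j}; and (b) the exterior boundary in ℤ⁴ satisfies ∂(𝒞_L^{(i)} \ 𝒞_L^{(i+2)}) = ⋃_{j=1}^{L} ∂[(𝒮_{L,(i−2(j−1))₊} \ 𝒮_{L,(i−2(j−1)+2)₊}) × {j}]. -/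
/-- The `j`-th slice `(𝒮_{L,(i-2(j-1))₊} \ 𝒮_{L,(i-2(j-1)+2)₊}) × {j}` of
`𝒞_L^{(i)} \ 𝒞_L^{(i+2)}`. -/
noncomputable def cylSlice (L i j : ℕ) : Set (Site 4) :=
  layer (SL L (max ((i : ℝ) - 2 * ((j : ℝ) - 1)) 0)
      \ SL L (max ((i : ℝ) - 2 * ((j : ℝ) - 1) + 2) 0)) (j : ℤ)

/-- Adjacent sites of `ℤ⁴` at distinct heights agree horizontally, and their heights differ by
one. -/
lemma adjacent.vertical {x y : Site 4} (h : adjacent x y) (hne : x 3 ≠ y 3) :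
    (fun k : Fin 3 => x k.castSucc) = (fun k : Fin 3 => y k.castSucc) ∧
      (y 3 = x 3 + 1 ∨ x 3 = y 3 + 1) := by
  have h' : |x 0 - y 0| + |x 1 - y 1| + |x 2 - y 2| + |x 3 - y 3| = 1 := by
    simpa [adjacent, Fin.sum_univ_four] using h
  have h3 : 1 ≤ |x 3 - y 3| := Int.one_le_abs (sub_ne_zero.mpr hne)
  have a0 := abs_nonneg (x 0 - y 0)
  have a1 := abs_nonneg (x 1 - y 1)
  have a2 := abs_nonneg (x 2 - y 2)
  have e0 : x 0 = y 0 := sub_eq_zero.mp (abs_eq_zero.mp (by omega))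
  have e1 : x 1 = y 1 := sub_eq_zero.mp (abs_eq_zero.mp (by omega))
  have e2 : x 2 = y 2 := sub_eq_zero.mp (abs_eq_zero.mp (by omega))
  refine ⟨?_, ?_⟩
  · funext k
    fin_cases k
    exacts [e0, e1, e2]
  · rcases (abs_eq (by norm_num)).mp (by omega : |x 3 - y 3| = 1) with h | h <;> omega

/-- The exterior boundary of a union of pairwise non-touching sets is the union of the exterior
boundaries. -/
lemma extBoundary_biUnion {d : ℕ} {ι : Type*} (s : Set ι) (A : ι → Set (Site d))
    (h : ∀ j ∈ s, ∀ j' ∈ s, ∀ x ∈ A j, ∀ y ∈ A j', adjacent x y → y ∈ A j) :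
    extBoundary (⋃ j ∈ s, A j) = ⋃ j ∈ s, extBoundary (A j) := by
  ext y
  simp only [extBoundary, Set.mem_ofPred_eq, Set.mem_iUnion, exists_prop]
  constructor
  · rintro ⟨hy, x, ⟨j, hj, hx⟩, hxy⟩
    exact ⟨j, hj, fun hyj => hy ⟨j, hj, hyj⟩, x, hx, hxy⟩
  · rintro ⟨j, hj, hy, x, hx, hxy⟩
    exact ⟨fun ⟨j', hj', hy'⟩ => hy (h j hj j' hj' x hx y hy' hxy), x, ⟨j, hj, hx⟩, hxy⟩

/-- The balls `𝒮_{L,k}` with `0 ≤ k ≤ 8L` are contained in the base of the cylinder. -/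
lemma SL_subset_base {L : ℕ} {k : ℝ} (hk : 0 ≤ k) (hkL : k ≤ 8 * L) :
    SL L k ⊆ ball3 (8 * L * Real.log L ^ c₂) := by
  intro z hz
  have hlog : 0 ≤ Real.log L ^ c₂ := Real.rpow_nonneg (Real.log_natCast_nonneg L) _
  simp only [SL, ball3, Set.mem_ofPred_eq] at hz ⊢
  refine hz.trans (pow_le_pow_left₀ ?_ ?_ 2)
  · exact mul_nonneg (by linarith) hlog
  · exact mul_le_mul_of_nonneg_right (by linarith) hlog

lemma cylI_diff_eq_iUnion_cylSlice {L i : ℕ} (hi : i ≤ 4 * L) :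
    cylI L i \ cylI L (i + 2) = ⋃ j ∈ Finset.Icc 1 L, cylSlice L i j := by
  have index (t : ℝ) : (i : ℝ) - 2 * t + 2 = i - 2 * (t - 1) ∧
      ((i + 2 : ℕ) : ℝ) - 2 * t + 2 = i - 2 * (t - 1) + 2 := by
    constructor <;> push_cast <;> ring
  have hiL : (i : ℝ) ≤ 4 * L := mod_cast hi
  ext z
  simp only [cylI, cylSlice, layer, Set.mem_sdiff, Set.mem_inter_iff, Set.mem_ofPred_eq,
    Set.mem_iUnion, exists_prop, Finset.mem_Icc, (index _).1, (index _).2]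
  constructor
  · rintro ⟨⟨hc, hz⟩, hn⟩
    obtain ⟨-, h1, hL⟩ := id hc
    obtain ⟨j, hj⟩ := Int.eq_ofNat_of_zero_le (by omega : 0 ≤ z 3)
    have hjR : (z 3 : ℝ) = j := by rw [hj]; simp
    rw [hjR] at hz hn
    exact ⟨j, by omega, ⟨hz, fun h => hn ⟨hc, h⟩⟩, hj⟩
  · rintro ⟨j, ⟨h1, hL⟩, ⟨hz, hn⟩, hj⟩
    have hjR : (z 3 : ℝ) = j := by rw [hj]; simp
    have h1R : (1 : ℝ) ≤ j := mod_cast h1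
    have hbase := SL_subset_base (L := L) (le_max_right _ _)
      (max_le (by linarith) (by positivity)) hz
    rw [hjR]
    exact ⟨⟨⟨hbase, by omega, by omega⟩, hz⟩, fun h => hn h.2⟩

/-- Distinct slices do not touch. -/
lemma mem_cylSlice_of_adjacent {L i j j' : ℕ} {x y : Site 4} (hx : x ∈ cylSlice L i j)
    (hy : y ∈ cylSlice L i j') (hxy : adjacent x y) : y ∈ cylSlice L i j := by
  obtain ⟨⟨hx, hx'⟩, hx3⟩ := id hx
  obtain ⟨⟨hy, hy'⟩, hy3⟩ := id hy
  by_cases hjj : j = j'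
  · subst hjj
    assumption
  have index (t : ℝ) : (i : ℝ) - 2 * (t + 1 - 1) + 2 = i - 2 * (t - 1) := by ring
  obtain ⟨hxy', h | h⟩ := hxy.vertical (by omega)
  · obtain rfl : j' = j + 1 := by omega
    rw [← hxy'] at hy'
    push_cast at hy'
    rw [index] at hy'
    exact (hy' hx).elim
  · obtain rfl : j = j' + 1 := by omega
    rw [hxy'] at hx'
    push_cast at hx'
    rw [index] at hx'
    exact (hx' hy).elim

/-- For every sufficiently large `L` and every `i ∈ {0,…,4L}`:
(a) `𝒞_L^{(i)} \ 𝒞_L^{(i+2)}` is the disjoint union over `j ∈ {1,…,L}` of the slices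
`(𝒮_{L,(i-2(j-1))₊} \ 𝒮_{L,(i-2(j-1)+2)₊}) × {j}`; and (b) its exterior boundary in
`ℤ⁴` is the union of the exterior boundaries of the slices. -/
theorem slice_decomposition :
    ∃ L₀ : ℕ, ∀ L : ℕ, L₀ ≤ L → ∀ i : ℕ, i ≤ 4 * L →
      (cylI L i \ cylI L (i + 2) = ⋃ j ∈ Finset.Icc 1 L, cylSlice L i j) ∧
        ((Finset.Icc 1 L : Finset ℕ) : Set ℕ).Pairwise
          (fun j j' => Disjoint (cylSlice L i j) (cylSlice L i j')) ∧
        extBoundary (cylI L i \ cylI L (i + 2))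
          = ⋃ j ∈ Finset.Icc 1 L, extBoundary (cylSlice L i j) := by
  refine ⟨0, fun L _ i hi => ⟨cylI_diff_eq_iUnion_cylSlice hi, ?_, ?_⟩⟩
  · intro j _ j' _ hne
    exact Set.disjoint_left.mpr fun z hz hz' => hne (Int.ofNat_inj.mp (hz.2.symm.trans hz'.2))
  · rw [cylI_diff_eq_iUnion_cylSlice hi]
    exact extBoundary_biUnion (Finset.Icc 1 L : Finset ℕ) (cylSlice L i)
      fun _ _ _ _ _ hx _ hy hxy => mem_cylSlice_of_adjacent hx hy hxy
end
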